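/- arXiv:0904.4774 — 2 statements merged into one kernel-verified Lean document; each statement's English description precedes it below -/
import Mathlib

section
/- Let D₀ be a d×K real matrix with unit Euclidean-norm columns whose columns span ℝ^d, let X₀ be a K×N real matrix, Y = D₀·X₀, M₀ := D₀ᵀD₀ − I, and define the K×K matrix U := sign(X₀)·X₀ᵀ − M₀ᵀ·diag(‖x^k‖₁)_{k=1,…,K}. If for every K×K zero-diagonal matrix Z and every K×N matrix V with D₀·V = 0 such that Z·X₀ + V ≠ 0 one has |⟨Z, U⟩_F + ⟨V, sign(X₀)⟩_F| < ‖(Z·X₀ + V)_Λ‖₁, then (D₀,X₀) is a strict local minimum of problem (P1'). -/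
open Matrix Finset

noncomputable section

/-- Entrywise ℓ1 norm of a matrix: the sum of absolute values of all entries. -/
def l1Norm {m n : Type*} [Fintype m] [Fintype n] (X : Matrix m n ℝ) : ℝ :=
  ∑ i, ∑ j, |X i j|

/-- The dictionary has unit Euclidean-norm columns. -/
def UnitCols {d K : ℕ} (D : Matrix (Fin d) (Fin K) ℝ) : Prop :=
  ∀ k, ∑ i, (D i k) ^ 2 = 1

/-- `(D₀, X₀)` is a strict local minimum of problem (P1'). -/
def IsStrictLocalMinP1 {d K N : ℕ} (Y : Matrix (Fin d) (Fin N) ℝ)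
    (D₀ : Matrix (Fin d) (Fin K) ℝ) (X₀ : Matrix (Fin K) (Fin N) ℝ) : Prop :=
  ∃ U ∈ nhds (D₀, X₀), ∀ DX ∈ U, UnitCols DX.1 → DX.1 * DX.2 = Y →
    l1Norm X₀ ≤ l1Norm DX.2 ∧ (DX.2 ≠ X₀ → l1Norm X₀ < l1Norm DX.2)

/-- Entrywise sign of a matrix (with `sign 0 = 0`). -/
def signM {m n : Type*} (X : Matrix m n ℝ) : Matrix m n ℝ :=
  Matrix.of fun i j => Real.sign (X i j)

/-- Frobenius inner product `⟨A, B⟩_F = trace(Aᵀ B)`. -/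
def frob {m n : Type*} [Fintype m] [Fintype n] (A B : Matrix m n ℝ) : ℝ :=
  Matrix.trace (Aᵀ * B)

/-- `‖A_Λ‖₁`: the ℓ1 norm of `A` restricted to the indices where `X₀` vanishes. -/
def l1OnZeros {K N : ℕ} (X₀ A : Matrix (Fin K) (Fin N) ℝ) : ℝ :=
  ∑ k, ∑ n, if X₀ k n = 0 then |A k n| else 0

/-- The matrix `U := sign(X₀)·X₀ᵀ − M₀ᵀ·diag(‖x^k‖₁)_k`, where `M₀ = D₀ᵀD₀ − I`. -/
def Umatrix {d K N : ℕ} (D₀ : Matrix (Fin d) (Fin K) ℝ)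
    (X₀ : Matrix (Fin K) (Fin N) ℝ) : Matrix (Fin K) (Fin K) ℝ :=
  signM X₀ * X₀ᵀ - (D₀ᵀ * D₀ - 1)ᵀ * Matrix.diagonal (fun k => ∑ n, |X₀ k n|)

/-- A linear functional dominated strictly by an absolutely homogeneous continuous function
of the image of a linear map into a finite-dimensional space is dominated with a uniform gap. -/
theorem exists_uniform_gap {E F : Type*} [AddCommGroup E] [Module ℝ E]
    [NormedAddCommGroup F] [NormedSpace ℝ F] [FiniteDimensional ℝ F]
    (L : E →ₗ[ℝ] F) (f : E →ₗ[ℝ] ℝ) (p : F → ℝ) (hp : Continuous p)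
    (hhom : ∀ (t : ℝ) (x : F), p (t • x) = |t| * p x)
    (hker : ∀ e, L e = 0 → f e = 0) (hlt : ∀ e, L e ≠ 0 → |f e| < p (L e)) :
    ∃ c > 0, ∀ e, c * ‖L e‖ + |f e| ≤ p (L e) := by
  obtain ⟨g, hg⟩ : ∃ g : F →ₗ[ℝ] ℝ, g ∘ₗ L = f := by
    have : f ∈ LinearMap.range L.dualMap := by
      rw [LinearMap.range_dualMap_eq_dualAnnihilator_ker, Submodule.mem_dualAnnihilator]
      exact fun e he => hker e (LinearMap.mem_ker.1 he)
    obtain ⟨g, hg⟩ := this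
    exact ⟨g, hg⟩
  have hgf : ∀ e, g (L e) = f e := fun e => LinearMap.congr_fun hg e
  have hgc : Continuous g := g.continuous_of_finiteDimensional
  have hp0 : p 0 = 0 := by simpa using hhom 0 0
  have hcomp : IsCompact (Metric.sphere (0 : F) 1 ∩ (LinearMap.range L : Set F)) :=
    haveI := FiniteDimensional.proper_real F
    (isCompact_sphere 0 1).inter_right (LinearMap.range L).closed_of_finiteDimensional
  obtain ⟨c, hc, hcle⟩ : ∃ c > 0, ∀ x ∈ Metric.sphere (0 : F) 1 ∩ (LinearMap.range L : Set F),
      c ≤ p x - |g x| := by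
    rcases (Metric.sphere (0 : F) 1 ∩ (LinearMap.range L : Set F)).eq_empty_or_nonempty
      with he | hne
    · exact ⟨1, one_pos, by simp [he]⟩
    · obtain ⟨x, hx, hmin⟩ := hcomp.exists_isMinOn hne (f := fun x => p x - |g x|)
        (by fun_prop)
      refine ⟨p x - |g x|, ?_, fun y hy => hmin hy⟩
      obtain ⟨hx1, e, rfl⟩ := hx
      have : L e ≠ 0 := by
        intro h0
        simp [h0] at hx1
      have := hlt e this
      rw [hgf]
      linarith
  refine ⟨c, hc, fun e => ?_⟩
  by_cases h0 : L e = 0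
  · simp [h0, hker e h0, hp0]
  have hn : 0 < ‖L e‖ := norm_pos_iff.2 h0
  have := hcle (‖L e‖⁻¹ • L e) ⟨by simp [norm_smul, hn.ne'],
    (LinearMap.range L).smul_mem _ (LinearMap.mem_range_self L e)⟩
  rw [hhom, map_smul, hgf, smul_eq_mul, abs_mul, abs_of_pos (inv_pos.2 hn), ← mul_sub,
    inv_mul_eq_div, le_div_iff₀ hn] at this
  linarith

section L1

variable {l m n : Type*} [Fintype l] [Fintype m] [Fintype n]

theorem frob_eq_sum (A B : Matrix m n ℝ) : frob A B = ∑ i, ∑ j, A i j * B i j := by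
  simp only [frob, Matrix.trace, Matrix.diag, Matrix.mul_apply, Matrix.transpose_apply]
  exact Finset.sum_comm

theorem frob_add_left (A B C : Matrix m n ℝ) : frob (A + B) C = frob A C + frob B C := by
  simp [frob, Matrix.add_mul]

theorem frob_smul_left (t : ℝ) (A B : Matrix m n ℝ) : frob (t • A) B = t * frob A B := by
  simp [frob]

theorem l1Norm_nonneg (A : Matrix m n ℝ) : 0 ≤ l1Norm A :=
  Finset.sum_nonneg fun _ _ => Finset.sum_nonneg fun _ _ => abs_nonneg _

theorem abs_le_l1Norm (A : Matrix m n ℝ) (i : m) (j : n) : |A i j| ≤ l1Norm A :=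
  (Finset.single_le_sum (f := fun j => |A i j|) (fun _ _ => abs_nonneg _)
    (Finset.mem_univ j)).trans
    (Finset.single_le_sum (f := fun i => ∑ j, |A i j|)
      (fun _ _ => Finset.sum_nonneg fun _ _ => abs_nonneg _) (Finset.mem_univ i))

theorem l1Norm_pos {A : Matrix m n ℝ} (hA : A ≠ 0) : 0 < l1Norm A := by
  obtain ⟨i, j, hij⟩ : ∃ i j, A i j ≠ 0 := by
    by_contra! hzero
    exact hA (Matrix.ext hzero)
  exact (abs_pos.2 hij).trans_le (abs_le_l1Norm A i j)

theorem l1Norm_add_le (A B : Matrix m n ℝ) : l1Norm (A + B) ≤ l1Norm A + l1Norm B := by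
  simp only [l1Norm, ← Finset.sum_add_distrib]
  exact Finset.sum_le_sum fun _ _ => Finset.sum_le_sum fun _ _ => abs_add_le _ _

theorem l1Norm_mul_le (A : Matrix l m ℝ) (B : Matrix m n ℝ) :
    l1Norm (A * B) ≤ l1Norm A * l1Norm B := by
  have hrow : ∀ k, ∑ j, |B k j| ≤ l1Norm B := fun k =>
    Finset.single_le_sum (f := fun k => ∑ j, |B k j|)
      (fun _ _ => Finset.sum_nonneg fun _ _ => abs_nonneg _) (Finset.mem_univ k)
  calc l1Norm (A * B) ≤ ∑ i, ∑ j, ∑ k, |A i k| * |B k j| := by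
        refine Finset.sum_le_sum fun i _ => Finset.sum_le_sum fun j _ => ?_
        simp only [← abs_mul]
        exact Finset.abs_sum_le_sum_abs _ _
    _ = ∑ i, ∑ k, |A i k| * ∑ j, |B k j| := by
        refine Finset.sum_congr rfl fun i _ => ?_
        rw [Finset.sum_comm]
        simp only [Finset.mul_sum]
    _ ≤ ∑ i, ∑ k, |A i k| * l1Norm B := by
        gcongr with i _ k _
        exact hrow k
    _ = l1Norm A * l1Norm B := by simp only [l1Norm, Finset.sum_mul]

theorem abs_real_sign_le_one (x : ℝ) : |Real.sign x| ≤ 1 := by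
  rcases Real.sign_apply_eq x with h | h | h <;> simp [h]

theorem abs_frob_signM_le (A X : Matrix m n ℝ) : |frob A (signM X)| ≤ l1Norm A := by
  rw [frob_eq_sum]
  refine (Finset.abs_sum_le_sum_abs _ _).trans (Finset.sum_le_sum fun i _ =>
    (Finset.abs_sum_le_sum_abs _ _).trans (Finset.sum_le_sum fun j _ => ?_))
  rw [abs_mul]
  exact mul_le_of_le_one_right (abs_nonneg _) (abs_real_sign_le_one _)

end L1

section Zeros

variable {K N : ℕ} (X₀ : Matrix (Fin K) (Fin N) ℝ)

theorem l1OnZeros_smul (t : ℝ) (A : Matrix (Fin K) (Fin N) ℝ) :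
    l1OnZeros X₀ (t • A) = |t| * l1OnZeros X₀ A := by
  simp only [l1OnZeros, Finset.mul_sum]
  refine Finset.sum_congr rfl fun i _ => Finset.sum_congr rfl fun j _ => ?_
  split_ifs <;> simp [abs_mul]

theorem continuous_l1OnZeros : Continuous (l1OnZeros X₀) := by
  unfold l1OnZeros
  refine continuous_finsetSum _ fun i _ => continuous_finsetSum _ fun j _ => ?_
  split_ifs <;> fun_prop

theorem l1OnZeros_le_add (A B : Matrix (Fin K) (Fin N) ℝ) :
    l1OnZeros X₀ A ≤ l1OnZeros X₀ (A + B) + l1Norm B := by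
  simp only [l1OnZeros, l1Norm, ← Finset.sum_add_distrib]
  refine Finset.sum_le_sum fun i _ => Finset.sum_le_sum fun j _ => ?_
  split_ifs
  · have := abs_sub (A i j + B i j) (B i j)
    simpa using this
  · simp

/-- The subgradient inequality for the `ℓ1` norm at `X₀`. -/
theorem l1Norm_add_ge (W : Matrix (Fin K) (Fin N) ℝ) :
    l1Norm X₀ + frob W (signM X₀) + l1OnZeros X₀ W ≤ l1Norm (X₀ + W) := by
  simp only [frob_eq_sum, l1OnZeros, l1Norm, ← Finset.sum_add_distrib]
  refine Finset.sum_le_sum fun i _ => Finset.sum_le_sum fun j _ => ?_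
  simp only [signM, Matrix.of_apply, Matrix.add_apply]
  rcases lt_trichotomy (X₀ i j) 0 with hx | hx | hx
  · rw [Real.sign_of_neg hx, if_neg hx.ne, abs_of_neg hx]
    linarith [neg_le_abs (X₀ i j + W i j)]
  · simp [hx]
  · rw [Real.sign_of_pos hx, if_neg hx.ne', abs_of_pos hx]
    linarith [le_abs_self (X₀ i j + W i j)]

end Zeros

section Dictionary

variable {d K N : ℕ} {D₀ : Matrix (Fin d) (Fin K) ℝ} {X₀ : Matrix (Fin K) (Fin N) ℝ}

theorem frob_Umatrix_add (Z : Matrix (Fin K) (Fin K) ℝ) (V : Matrix (Fin K) (Fin N) ℝ) :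
    frob Z (Umatrix D₀ X₀) + frob V (signM X₀) =
      frob (Z * X₀ + V) (signM X₀) -
        ∑ k, ((D₀ᵀ * D₀ - 1) * Z : Matrix (Fin K) (Fin K) ℝ) k k * ∑ n, |X₀ k n| := by
  have h1 : frob Z (signM X₀ * X₀ᵀ) = frob (Z * X₀) (signM X₀) := by
    simp only [frob, Matrix.transpose_mul]
    rw [← Matrix.mul_assoc, Matrix.trace_mul_comm, Matrix.mul_assoc]
  have h2 : frob Z ((D₀ᵀ * D₀ - 1)ᵀ * Matrix.diagonal (fun k => ∑ n, |X₀ k n|)) =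
      ∑ k, ((D₀ᵀ * D₀ - 1) * Z : Matrix (Fin K) (Fin K) ℝ) k k * ∑ n, |X₀ k n| := by
    rw [frob, ← Matrix.mul_assoc, ← Matrix.transpose_mul]
    simp only [Matrix.trace, Matrix.diag, Matrix.mul_diagonal, Matrix.transpose_apply]
  have h3 : frob Z (Umatrix D₀ X₀) = frob Z (signM X₀ * X₀ᵀ) -
      frob Z ((D₀ᵀ * D₀ - 1)ᵀ * Matrix.diagonal (fun k => ∑ n, |X₀ k n|)) := by
    simp only [frob, Umatrix, Matrix.mul_sub, Matrix.trace_sub]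
  rw [h3, h1, h2, frob_add_left]
  ring

theorem frob_Umatrix_add_eq_zero
    (h : ∀ (Z : Matrix (Fin K) (Fin K) ℝ) (V : Matrix (Fin K) (Fin N) ℝ),
      (∀ k, Z k k = 0) → D₀ * V = 0 → Z * X₀ + V ≠ 0 →
        |frob Z (Umatrix D₀ X₀) + frob V (signM X₀)| < l1OnZeros X₀ (Z * X₀ + V))
    {Z : Matrix (Fin K) (Fin K) ℝ} {V : Matrix (Fin K) (Fin N) ℝ}
    (hZ : ∀ k, Z k k = 0) (hV : D₀ * V = 0) (hG : Z * X₀ + V = 0) :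
    frob Z (Umatrix D₀ X₀) + frob V (signM X₀) = 0 := by
  by_cases hex : ∃ (Z' : Matrix (Fin K) (Fin K) ℝ) (V' : Matrix (Fin K) (Fin N) ℝ),
      (∀ k, Z' k k = 0) ∧ D₀ * V' = 0 ∧ Z' * X₀ + V' ≠ 0
  · obtain ⟨Z', V', hZ', hV', hG'⟩ := hex
    by_contra hne
    set a := frob Z (Umatrix D₀ X₀) + frob V (signM X₀) with ha
    set b := frob Z' (Umatrix D₀ X₀) + frob V' (signM X₀) with hb
    have key : ∀ t : ℝ, |b + t * a| < l1OnZeros X₀ (Z' * X₀ + V') := by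
      intro t
      have hG'' : (Z' + t • Z) * X₀ + (V' + t • V) = Z' * X₀ + V' := by
        have : (Z' + t • Z) * X₀ + (V' + t • V) = Z' * X₀ + V' + t • (Z * X₀ + V) := by
          rw [Matrix.add_mul, Matrix.smul_mul, smul_add]
          abel
        rw [this, hG, smul_zero, add_zero]
      have := h (Z' + t • Z) (V' + t • V) (by simp [hZ, hZ'])
        (by simp [Matrix.mul_add, hV, hV']) (by rwa [hG''])
      rw [hG''] at this
      convert this using 2
      simp only [frob_add_left, frob_smul_left, ha, hb]
      ring
    have := key ((l1OnZeros X₀ (Z' * X₀ + V') - b) / a)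
    rw [div_mul_cancel₀ _ hne, add_sub_cancel] at this
    exact (le_abs_self _).not_gt this
  · push Not at hex
    have hcol : ∀ i k, Z i k * ∑ n, |X₀ k n| = 0 := by
      intro i k
      by_cases hik : i = k
      · simp [hik, hZ]
      have hs := hex (Matrix.single i k 1) 0
        (fun j => Matrix.single_apply_of_ne _ _ _ _ _ (by rintro ⟨rfl, rfl⟩; exact hik rfl))
        (by simp)
      have hrow : ∀ n, X₀ k n = 0 := fun n => by
        simpa using congrFun (congrFun hs i) n
      simp [hrow]
    rw [frob_Umatrix_add, hG]
    have : ∀ k, ((D₀ᵀ * D₀ - 1) * Z : Matrix (Fin K) (Fin K) ℝ) k k * ∑ n, |X₀ k n| = 0 := by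
      intro k
      rw [Matrix.mul_apply, Finset.sum_mul]
      exact Finset.sum_eq_zero fun i _ => by rw [mul_assoc, hcol, mul_zero]
    simp [this, frob]

open scoped Matrix.Norms.Elementwise in
theorem exists_l1Norm_gap
    (h : ∀ (Z : Matrix (Fin K) (Fin K) ℝ) (V : Matrix (Fin K) (Fin N) ℝ),
      (∀ k, Z k k = 0) → D₀ * V = 0 → Z * X₀ + V ≠ 0 →
        |frob Z (Umatrix D₀ X₀) + frob V (signM X₀)| < l1OnZeros X₀ (Z * X₀ + V)) :
    ∃ c > 0, ∀ (Z : Matrix (Fin K) (Fin K) ℝ) (V : Matrix (Fin K) (Fin N) ℝ),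
      (∀ k, Z k k = 0) → D₀ * V = 0 →
        c * l1Norm (Z * X₀ + V) + |frob Z (Umatrix D₀ X₀) + frob V (signM X₀)| ≤
          l1OnZeros X₀ (Z * X₀ + V) := by
  let S : Submodule ℝ (Matrix (Fin K) (Fin K) ℝ × Matrix (Fin K) (Fin N) ℝ) :=
    { carrier := {q | (∀ k, q.1 k k = 0) ∧ D₀ * q.2 = 0}
      add_mem' := fun {a b} ha hb =>
        ⟨fun k => by simp [ha.1 k, hb.1 k], by simp [Matrix.mul_add, ha.2, hb.2]⟩
      zero_mem' := by simp
      smul_mem' := fun t a ha => ⟨fun k => by simp [ha.1 k], by simp [ha.2]⟩ }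
  let L : S →ₗ[ℝ] Matrix (Fin K) (Fin N) ℝ :=
    { toFun := fun q => q.1.1 * X₀ + q.1.2
      map_add' := fun a b => by simp [Matrix.add_mul]; abel
      map_smul' := fun t a => by simp }
  let f : S →ₗ[ℝ] ℝ :=
    { toFun := fun q => frob q.1.1 (Umatrix D₀ X₀) + frob q.1.2 (signM X₀)
      map_add' := fun a b => by simp [frob_add_left]; ring
      map_smul' := fun t a => by simp [frob_smul_left]; ring }
  obtain ⟨c, hc, hgap⟩ := exists_uniform_gap L f (l1OnZeros X₀) (continuous_l1OnZeros X₀)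
    (l1OnZeros_smul X₀)
    (fun q hq => frob_Umatrix_add_eq_zero h q.2.1 q.2.2 hq)
    (fun q hq => h q.1.1 q.1.2 q.2.1 q.2.2 hq)
  have hle : ∀ A : Matrix (Fin K) (Fin N) ℝ, l1Norm A ≤ (K * N + 1) * ‖A‖ := by
    intro A
    calc l1Norm A ≤ ∑ _i : Fin K, ∑ _j : Fin N, ‖A‖ := by
          refine Finset.sum_le_sum fun i _ => Finset.sum_le_sum fun j _ => ?_
          exact Matrix.norm_entry_le_entrywise_sup_norm A
      _ = K * N * ‖A‖ := by simp [mul_assoc]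
      _ ≤ (K * N + 1) * ‖A‖ := by nlinarith [norm_nonneg A]
  have hpos : (0 : ℝ) < K * N + 1 := by positivity
  refine ⟨c / (K * N + 1), by positivity, fun Z V hZ hV => ?_⟩
  have h1 : c / (K * N + 1) * l1Norm (Z * X₀ + V) ≤ c * ‖Z * X₀ + V‖ := by
    rw [div_mul_eq_mul_div, div_le_iff₀ hpos]
    nlinarith [hle (Z * X₀ + V)]
  have h2 := hgap ⟨(Z, V), hZ, hV⟩
  exact (add_le_add_left h1 _).trans h2

/-- Every dictionary `D` near `D₀` is of the form `D₀ * (1 - Z) * diagonal c` with `Z` small and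
zero-diagonal, and `c` positive. -/
theorem eventually_exists_factorization (hcomplete : Function.Surjective D₀.mulVec)
    {ε : ℝ} (hε : 0 < ε) :
    ∀ᶠ D in nhds D₀, ∃ (Z : Matrix (Fin K) (Fin K) ℝ) (c : Fin K → ℝ),
      (∀ k, Z k k = 0) ∧ (∀ k, 0 < c k) ∧ l1Norm Z < ε ∧
        D = D₀ * (1 - Z) * Matrix.diagonal c := by
  obtain ⟨R, hR⟩ := Matrix.mulVec_surjective_iff_exists_right_inverse.1 hcomplete
  let C : Matrix (Fin d) (Fin K) ℝ → Matrix (Fin K) (Fin K) ℝ := fun D => 1 + R * (D - D₀)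
  let Q : Matrix (Fin d) (Fin K) ℝ → Matrix (Fin K) (Fin K) ℝ :=
    fun D => Matrix.of fun i k => if i = k then 0 else -(C D i k / C D k k)
  have hC : Continuous C := by fun_prop
  have hCe : ∀ i k, Continuous fun D => C D i k := fun i k => hC.matrix_elem i k
  have hC0 : C D₀ = 1 := by simp [C]
  have hQ : ContinuousAt (fun D => l1Norm (Q D)) D₀ := by
    unfold l1Norm
    refine tendsto_finsetSum _ fun i _ => tendsto_finsetSum _ fun k _ => ?_
    refine ContinuousAt.abs (f := fun D => Q D i k) ?_
    by_cases hik : i = k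
    · simpa [Q, hik] using continuousAt_const
    · simp only [Q, hik, Matrix.of_apply, if_false]
      exact ((hCe i k).continuousAt.div (hCe k k).continuousAt (by simp [hC0])).neg
  have hQ0 : l1Norm (Q D₀) = 0 := by
    refine Finset.sum_eq_zero fun i _ => Finset.sum_eq_zero fun k _ => ?_
    by_cases hik : i = k <;> simp [Q, hC0, hik]
  have e1 : ∀ᶠ D in nhds D₀, l1Norm (Q D) < ε :=
    hQ.eventually_lt continuousAt_const (by rwa [hQ0])
  have e2 : ∀ᶠ D in nhds D₀, ∀ k, 0 < C D k k := by
    refine Filter.eventually_all.2 fun k => ?_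
    exact continuousAt_const.eventually_lt (hCe k k).continuousAt (by simp [hC0])
  filter_upwards [e1, e2] with D h1 h2
  refine ⟨Q D, fun k => C D k k, fun k => by simp [Q], h2, h1, ?_⟩
  have hfac : (1 - Q D) * Matrix.diagonal (fun k => C D k k) = C D := by
    ext i k
    rw [Matrix.mul_diagonal]
    by_cases hik : i = k
    · simp [Q, hik]
    · simp [Q, hik, (h2 k).ne']
  rw [Matrix.mul_assoc, hfac]
  simp only [C, Matrix.mul_add, ← Matrix.mul_assoc, hR, Matrix.mul_one, Matrix.one_mul]
  abel

theorem transpose_mul_diag_le_one_of_unitCols {D : Matrix (Fin d) (Fin K) ℝ} (hD₀ : UnitCols D₀)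
    (hD : UnitCols D) (k : Fin K) :
    (D₀ᵀ * D) k k ≤ 1 ∧ ((D₀ᵀ * D) k k = 1 → ∀ i, D i k = D₀ i k) := by
  have hsq : ∑ i, (D i k - D₀ i k) ^ 2 = 2 - 2 * (D₀ᵀ * D) k k := by
    have : ∀ i, (D i k - D₀ i k) ^ 2 = D i k ^ 2 + D₀ i k ^ 2 - 2 * (D₀ i k * D i k) :=
      fun i => by ring
    simp only [this, Finset.sum_sub_distrib, Finset.sum_add_distrib, ← Finset.mul_sum, hD k,
      hD₀ k, Matrix.mul_apply, Matrix.transpose_apply]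
    ring
  constructor
  · have : 0 ≤ ∑ i, (D i k - D₀ i k) ^ 2 := Finset.sum_nonneg fun _ _ => sq_nonneg _
    linarith
  · intro h1 i
    rw [h1, mul_one, sub_self, Finset.sum_eq_zero_iff_of_nonneg fun _ _ => sq_nonneg _] at hsq
    exact sub_eq_zero.1 (pow_eq_zero_iff two_ne_zero |>.1 (hsq i (Finset.mem_univ i)))

end Dictionary

/-- **Lemma (sufficient condition for a strict local minimum).** If for every
zero-diagonal `Z` and every `V` with `D₀·V = 0` such that `Z·X₀ + V ≠ 0` one has
`|⟨Z,U⟩_F + ⟨V, sign(X₀)⟩_F| < ‖(Z·X₀ + V)_Λ‖₁`, then `(D₀,X₀)` is a strict local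
minimum of (P1'). -/
theorem stmt7 {d K N : ℕ} (D₀ : Matrix (Fin d) (Fin K) ℝ)
    (X₀ : Matrix (Fin K) (Fin N) ℝ) (Y : Matrix (Fin d) (Fin N) ℝ)
    (hY : Y = D₀ * X₀)
    (hunit : UnitCols D₀)
    (hcomplete : Function.Surjective D₀.mulVec)
    (h : ∀ (Z : Matrix (Fin K) (Fin K) ℝ) (V : Matrix (Fin K) (Fin N) ℝ),
      (∀ k, Z k k = 0) → D₀ * V = 0 → Z * X₀ + V ≠ 0 →
        |frob Z (Umatrix D₀ X₀) + frob V (signM X₀)| < l1OnZeros X₀ (Z * X₀ + V)) :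
    IsStrictLocalMinP1 Y D₀ X₀ := by
  obtain ⟨c, hc, hgap⟩ := exists_l1Norm_gap h
  set M := l1Norm (D₀ᵀ * D₀ - 1) with hM
  have hM0 : 0 ≤ M := l1Norm_nonneg _
  have hε : 0 < c / (3 + M + c) := by positivity
  refine ⟨{D | ∃ (Z : Matrix (Fin K) (Fin K) ℝ) (a : Fin K → ℝ),
      (∀ k, Z k k = 0) ∧ (∀ k, 0 < a k) ∧ l1Norm Z < c / (3 + M + c) ∧
        D = D₀ * (1 - Z) * Matrix.diagonal a} ×ˢ Set.univ,
    prod_mem_nhds (eventually_exists_factorization hcomplete hε) Filter.univ_mem, ?_⟩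
  rintro ⟨D, X⟩ ⟨⟨Z, a, hZ, ha, hZε, hfac⟩, -⟩ hD hDX
  simp only at hD hDX hfac ⊢
  rw [hY] at hDX
  set m : Fin K → ℝ := fun k => ((D₀ᵀ * D₀ - 1) * Z : Matrix (Fin K) (Fin K) ℝ) k k with hm
  set X' := Matrix.diagonal a * X with hX'
  set W := X' - X₀ with hW
  set V := W - Z * X' with hV
  have hX'W : X' = X₀ + W := by rw [hW]; abel
  have hWG : W = Z * X₀ + V + Z * W := by
    rw [hV, hX'W, Matrix.mul_add]; abel
  have hDV : D₀ * V = 0 := by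
    have : D₀ * (1 - Z) * X' = D₀ * X₀ := by
      rw [← hDX, hfac, hX', Matrix.mul_assoc (D₀ * (1 - Z))]
    have hV' : V = (1 - Z) * X' - X₀ := by
      rw [hV, hW, Matrix.sub_mul, Matrix.one_mul]; abel
    rw [hV', Matrix.mul_sub, ← Matrix.mul_assoc, this, sub_self]
  have hX'e : ∀ k n, X' k n = a k * X k n := fun k n => by simp [hX']
  have hunit0 : ∀ k, (D₀ᵀ * D₀) k k = 1 := fun k => by
    simpa [Matrix.mul_apply, sq] using hunit k
  have hcorr : ∀ k, (D₀ᵀ * D) k k = a k * (1 - m k) := by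
    intro k
    have : m k = (D₀ᵀ * D₀ * Z) k k := by simp [hm, Matrix.sub_mul, hZ]
    rw [this, hfac, ← Matrix.mul_assoc, Matrix.mul_diagonal, ← Matrix.mul_assoc,
      Matrix.mul_sub, Matrix.mul_one, Matrix.sub_apply, hunit0]
    ring
  have hterm : ∀ k n, (1 - m k) * |X' k n| ≤ |X k n| := by
    intro k n
    have := (transpose_mul_diag_le_one_of_unitCols hunit hD k).1
    rw [hcorr] at this
    rw [hX'e, abs_mul, abs_of_pos (ha k)]
    nlinarith [abs_nonneg (X k n)]
  have hmk : ∀ k, |m k| ≤ M * l1Norm Z := fun k =>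
    (abs_le_l1Norm _ k k).trans (l1Norm_mul_le _ _)
  have hlow : l1Norm X' - ∑ k, m k * ∑ n, |X' k n| ≤ l1Norm X := by
    simp only [l1Norm, Finset.mul_sum, ← Finset.sum_sub_distrib]
    exact Finset.sum_le_sum fun k _ => Finset.sum_le_sum fun n _ => by linarith [hterm k n]
  have hmW : ∑ k, m k * ∑ n, |X' k n| ≤
      ∑ k, m k * ∑ n, |X₀ k n| + M * l1Norm Z * l1Norm W := by
    rw [show l1Norm W = ∑ k, ∑ n, |W k n| from rfl]
    simp only [Finset.mul_sum, ← Finset.sum_add_distrib]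
    refine Finset.sum_le_sum fun k _ => Finset.sum_le_sum fun n _ => ?_
    have h1 : |m k * (|X' k n| - |X₀ k n|)| ≤ M * l1Norm Z * |W k n| := by
      rw [abs_mul]
      exact mul_le_mul (hmk k) (abs_abs_sub_abs_le_abs_sub _ _) (abs_nonneg _)
        (mul_nonneg hM0 (l1Norm_nonneg _))
    linarith [(le_abs_self _).trans h1]
  have hsub := l1Norm_add_ge X₀ W
  rw [← hX'W] at hsub
  have hZW : l1Norm (Z * W) ≤ l1Norm Z * l1Norm W := l1Norm_mul_le Z W
  have hfrob : frob (Z * X₀ + V) (signM X₀) - l1Norm (Z * W) ≤ frob W (signM X₀) := by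
    conv_rhs => rw [hWG, frob_add_left]
    linarith [neg_abs_le (frob (Z * W) (signM X₀)), abs_frob_signM_le (Z * W) X₀]
  have hzeros : l1OnZeros X₀ (Z * X₀ + V) ≤ l1OnZeros X₀ W + l1Norm (Z * W) := by
    conv_rhs => enter [1]; rw [hWG]
    exact l1OnZeros_le_add X₀ _ _
  have hWle : l1Norm W ≤ l1Norm (Z * X₀ + V) + l1Norm (Z * W) := by
    conv_lhs => rw [hWG]
    exact l1Norm_add_le _ _
  have hg := hgap Z V hZ hDV
  have hU := frob_Umatrix_add (D₀ := D₀) (X₀ := X₀) Z V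
  have habs := neg_abs_le (frob Z (Umatrix D₀ X₀) + frob V (signM X₀))
  have hcW : c * l1Norm W ≤ c * l1Norm (Z * X₀ + V) + c * (l1Norm Z * l1Norm W) := by
    nlinarith
  have hmain : l1Norm X₀ + (c - l1Norm Z * (2 + M + c)) * l1Norm W ≤ l1Norm X := by
    linarith
  have hcoef : 0 < c - l1Norm Z * (2 + M + c) := by
    rw [lt_div_iff₀ (by positivity)] at hZε
    nlinarith [l1Norm_nonneg Z]
  refine ⟨by nlinarith [l1Norm_nonneg W], fun hne => ?_⟩
  by_cases hW0 : W = 0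
  swap
  · nlinarith [l1Norm_pos hW0]
  have hX'0 : X' = X₀ := by rw [hX'W, hW0, add_zero]
  by_contra! hle
  have hs : ∑ k, m k * ∑ n, |X' k n| ≤ 0 := by
    rw [hW0, Matrix.mul_zero, add_zero] at hWG
    have := frob_Umatrix_add_eq_zero h hZ hDV hWG.symm
    rw [hU, ← hWG] at this
    rw [hX'0]
    simp only [frob, Matrix.transpose_zero, Matrix.zero_mul, Matrix.trace_zero, zero_sub,
      neg_eq_zero] at this
    exact this.le
  have hsum : ∑ k, ∑ n, (|X k n| - (1 - m k) * |X' k n|) ≤ 0 := by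
    have : ∑ k, ∑ n, (|X k n| - (1 - m k) * |X' k n|) =
        l1Norm X - (l1Norm X' - ∑ k, m k * ∑ n, |X' k n|) := by
      simp only [l1Norm, Finset.mul_sum, ← Finset.sum_sub_distrib]
      exact Finset.sum_congr rfl fun k _ => Finset.sum_congr rfl fun n _ => by ring
    rw [this, hX'0] at *
    linarith
  have heq : ∀ k n, |X k n| = (1 - m k) * |X' k n| := by
    intro k n
    have h0 : ∀ k, ∀ n, 0 ≤ |X k n| - (1 - m k) * |X' k n| := fun k n =>
      sub_nonneg.2 (hterm k n)
    have h1 := Finset.single_le_sum (f := fun n => |X k n| - (1 - m k) * |X' k n|)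
      (fun n _ => h0 k n) (Finset.mem_univ n)
    have h2 := Finset.single_le_sum (f := fun k => ∑ n, (|X k n| - (1 - m k) * |X' k n|))
      (fun k _ => Finset.sum_nonneg fun n _ => h0 k n) (Finset.mem_univ k)
    linarith [h0 k n]
  have hDX0 : D * X = D₀ * X := by
    ext i n
    simp only [Matrix.mul_apply]
    refine Finset.sum_congr rfl fun k _ => ?_
    by_cases hX0 : X k n = 0
    · simp [hX0]
    · have h1 := heq k n
      rw [hX'e, abs_mul, abs_of_pos (ha k)] at h1
      have h2 : a k * (1 - m k) = 1 :=
        mul_right_cancel₀ (abs_ne_zero.2 hX0) (by linarith)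
      rw [(transpose_mul_diag_le_one_of_unitCols hunit hD k).2 (by rw [hcorr, h2]) i]
  have hlt := h 0 (X - X₀) (fun _ => rfl) (by rw [Matrix.mul_sub, ← hDX0, hDX, sub_self])
    (by simpa [sub_eq_zero] using hne)
  rw [Matrix.zero_mul, zero_add] at hlt
  have hz : l1OnZeros X₀ (X - X₀) = 0 := by
    refine Finset.sum_eq_zero fun k _ => Finset.sum_eq_zero fun n _ => ?_
    split_ifs with hx
    · have h1 := hX'e k n
      rw [hX'0, hx, eq_comm, mul_eq_zero] at h1
      simp [hx, h1.resolve_left (ha k).ne']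
    · rfl
  rw [hz] at hlt
  exact (abs_nonneg _).not_gt hlt
end
end

section
/- Let p ∈ (0,1) and N be a positive integer, and let x = (x_1,…,x_N) be a random vector in ℝ^N whose law is the N-fold product of the Bernoulli–Gaussian measure ν_p. Then for every ε > 0, ℙ( Σ_{n=1}^N |x_n| > N·p·(√(2/π) + ε) ) ≤ 2·exp( − N·p·ε² / (2 + √2·ε) ). -/
open MeasureTheory
open scoped ENNReal

noncomputable section

/-- The Bernoulli–Gaussian measure `ν_p = (1−p)·δ₀ + p·N(0,1)` on `ℝ`. -/
def bernoulliGaussian (p : ℝ) : Measure ℝ :=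
  (1 - p).toNNReal • Measure.dirac (0 : ℝ)
    + p.toNNReal • ProbabilityTheory.gaussianReal 0 1

instance (p : ℝ) : IsFiniteMeasure (bernoulliGaussian p) := by
  unfold bernoulliGaussian; infer_instance

/-- The absolute moments of the standard Gaussian measure, in terms of the Gamma function. -/
lemma integral_abs_pow_gaussianReal (k : ℕ) :
    ∫ x, |x| ^ k ∂(ProbabilityTheory.gaussianReal 0 1)
      = (Real.sqrt (2 * Real.pi))⁻¹ * (2 * ((1 / 2 : ℝ) ^ (-((k : ℝ) + 1) / 2) * (1 / 2)
        * Real.Gamma (((k : ℝ) + 1) / 2))) := by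
  rw [ProbabilityTheory.integral_gaussianReal_eq_integral_smul one_ne_zero,
    ← integral_rpow_mul_exp_neg_mul_rpow two_pos
      (by linarith [k.cast_nonneg (α := ℝ)] : (-1 : ℝ) < k) one_half_pos,
    ← integral_comp_abs (f := fun x : ℝ => x ^ (k : ℝ) * Real.exp (-(1 / 2) * x ^ (2 : ℝ))),
    ← integral_const_mul]
  refine integral_congr_ae (.of_forall fun x => ?_)
  have h : (-x ^ 2 / 2 : ℝ) = -(1 / 2) * x ^ 2 := by ring
  simp only [ProbabilityTheory.gaussianPDFReal_def, sub_zero, NNReal.coe_one, mul_one,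
    Real.rpow_natCast, Real.rpow_two, sq_abs, smul_eq_mul, h]
  ring

lemma integral_abs_pow_add_two_gaussianReal (k : ℕ) :
    ∫ x, |x| ^ (k + 2) ∂(ProbabilityTheory.gaussianReal 0 1)
      = (k + 1) * ∫ x, |x| ^ k ∂(ProbabilityTheory.gaussianReal 0 1) := by
  have hG : Real.Gamma ((((k + 2 : ℕ) : ℝ) + 1) / 2)
      = ((k : ℝ) + 1) / 2 * Real.Gamma (((k : ℝ) + 1) / 2) := by
    rw [← Real.Gamma_add_one (by positivity)]
    push_cast
    ring_nf
  have hpow : (1 / 2 : ℝ) ^ (-(((k + 2 : ℕ) : ℝ) + 1) / 2)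
      = (1 / 2 : ℝ) ^ (-((k : ℝ) + 1) / 2) * 2 := by
    rw [show -(((k + 2 : ℕ) : ℝ) + 1) / 2 = -((k : ℝ) + 1) / 2 - 1 by push_cast; ring,
      Real.rpow_sub_one (by norm_num)]
    ring
  rw [integral_abs_pow_gaussianReal, integral_abs_pow_gaussianReal, hG, hpow]
  ring

lemma integral_abs_gaussianReal :
    ∫ x, |x| ^ 1 ∂(ProbabilityTheory.gaussianReal 0 1) = Real.sqrt (2 / Real.pi) := by
  rw [integral_abs_pow_gaussianReal]
  have h : (-(((1 : ℕ) : ℝ) + 1) / 2) = -1 := by norm_num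
  have h' : ((((1 : ℕ) : ℝ) + 1) / 2) = 1 := by norm_num
  rw [h, h', Real.Gamma_one, Real.rpow_neg_one, Real.sqrt_mul (by norm_num),
    Real.sqrt_div (by norm_num)]
  have h2 : Real.sqrt 2 * Real.sqrt 2 = 2 := Real.mul_self_sqrt (by norm_num)
  have hpi : 0 < Real.sqrt Real.pi := Real.sqrt_pos.2 Real.pi_pos
  field_simp
  nlinarith

/-- Bernstein's moment condition for the absolute value of a standard Gaussian variable. -/
lemma integral_abs_pow_add_two_gaussianReal_le (k : ℕ) :
    (∫ x, |x| ^ (k + 2) ∂(ProbabilityTheory.gaussianReal 0 1)) / (k + 2).factorial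
      ≤ (Real.sqrt 2 / 2) ^ k / 2 := by
  have hs : Real.sqrt 2 ^ 2 = 2 := Real.sq_sqrt (by norm_num)
  induction k using Nat.twoStepInduction with
  | zero =>
    rw [integral_abs_pow_add_two_gaussianReal]
    simp
  | one =>
    rw [integral_abs_pow_add_two_gaussianReal, integral_abs_gaussianReal]
    have h : Real.sqrt (2 / Real.pi) ≤ 3 * Real.sqrt 2 / 4 := by
      apply Real.sqrt_le_iff.2 ⟨by positivity, ?_⟩
      rw [div_le_iff₀ Real.pi_pos]
      nlinarith [Real.pi_gt_three]
    rw [show Nat.factorial (1 + 2) = 6 from rfl, pow_one]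
    push_cast
    linarith
  | more k ih _ =>
    rw [integral_abs_pow_add_two_gaussianReal, Nat.factorial_succ, Nat.factorial_succ (k + 2)]
    have hm : 0 ≤ (∫ x, |x| ^ (k + 2) ∂(ProbabilityTheory.gaussianReal 0 1))
        / (k + 2).factorial :=
      div_nonneg (integral_nonneg fun x => by positivity) (by positivity)
    have hc : (Real.sqrt 2 / 2) ^ (k + 2) / 2 = (Real.sqrt 2 / 2) ^ k / 2 * (1 / 2) := by
      rw [pow_add, div_pow _ _ 2, hs]
      ring
    rw [hc]
    push_cast
    calc _ = (∫ x, |x| ^ (k + 2) ∂(ProbabilityTheory.gaussianReal 0 1)) / (k + 2).factorial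
          * (1 / (k + 4)) := by
          field_simp
          ring
      _ ≤ _ := by
          gcongr
          linarith [k.cast_nonneg (α := ℝ)]

lemma integrable_abs_pow_gaussianReal (k : ℕ) :
    Integrable (fun x : ℝ => |x| ^ k) (ProbabilityTheory.gaussianReal 0 1) :=
  (ProbabilityTheory.memLp_id_gaussianReal (k : NNReal)).integrable_norm_pow'

lemma integrable_exp_mul_abs_gaussianReal (t : ℝ) :
    Integrable (fun x : ℝ => Real.exp (t * |x|)) (ProbabilityTheory.gaussianReal 0 1) :=
  ProbabilityTheory.integrable_exp_mul_abs (X := id)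
    (ProbabilityTheory.integrable_exp_mul_gaussianReal t)
    (ProbabilityTheory.integrable_exp_mul_gaussianReal (-t))

/-- Bernstein's bound on the moment generating function of the absolute value of a standard
Gaussian variable. -/
lemma integral_exp_mul_abs_gaussianReal_le {t : ℝ} (ht : 0 ≤ t) (ht' : Real.sqrt 2 / 2 * t < 1) :
    ∫ x, Real.exp (t * |x|) ∂(ProbabilityTheory.gaussianReal 0 1)
      ≤ 1 + t * Real.sqrt (2 / Real.pi) + t ^ 2 / 2 * (1 - Real.sqrt 2 / 2 * t)⁻¹ := by
  set γ := ProbabilityTheory.gaussianReal 0 1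
  have hnorm (k : ℕ) (x : ℝ) : ‖(t * |x|) ^ k / k.factorial‖ = (t * |x|) ^ k / k.factorial :=
    Real.norm_of_nonneg (by positivity)
  have h_int (k : ℕ) : ∫ x, (t * |x|) ^ k / k.factorial ∂γ
      = t ^ k * ((∫ x, |x| ^ k ∂γ) / k.factorial) := by
    simp_rw [mul_pow]
    rw [integral_div, integral_const_mul, mul_div_assoc]
  have hgeom : HasSum (fun k : ℕ => t ^ 2 / 2 * (Real.sqrt 2 / 2 * t) ^ k)
      (t ^ 2 / 2 * (1 - Real.sqrt 2 / 2 * t)⁻¹) :=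
    (hasSum_geometric_of_lt_one (by positivity) ht').mul_left _
  have hle (k : ℕ) : t ^ (k + 2) * ((∫ x, |x| ^ (k + 2) ∂γ) / (k + 2).factorial)
      ≤ t ^ 2 / 2 * (Real.sqrt 2 / 2 * t) ^ k := by
    calc _ ≤ t ^ (k + 2) * ((Real.sqrt 2 / 2) ^ k / 2) := by
          exact mul_le_mul_of_nonneg_left (integral_abs_pow_add_two_gaussianReal_le k)
            (by positivity)
      _ = _ := by ring
  have hsum : Summable fun k : ℕ => t ^ k * ((∫ x, |x| ^ k ∂γ) / k.factorial) := by
    rw [← summable_nat_add_iff 2]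
    refine Summable.of_nonneg_of_le (fun k => ?_) hle hgeom.summable
    exact mul_nonneg (by positivity)
      (div_nonneg (integral_nonneg fun x => by positivity) (by positivity))
  have hexp : ∫ x, Real.exp (t * |x|) ∂γ
      = ∑' k : ℕ, t ^ k * ((∫ x, |x| ^ k ∂γ) / k.factorial) := by
    simp_rw [Real.exp_eq_exp_ℝ, ← (NormedSpace.expSeries_div_hasSum_exp (_ : ℝ)).tsum_eq]
    rw [← integral_tsum_of_summable_integral_norm]
    · simp_rw [h_int]
    · intro k
      simp_rw [mul_pow]
      exact ((integrable_abs_pow_gaussianReal k).const_mul _).div_const _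
    · simpa only [hnorm, h_int] using hsum
  rw [hexp, ← hsum.sum_add_tsum_nat_add 2, Finset.sum_range_succ, Finset.sum_range_one,
    integral_abs_gaussianReal, ← hgeom.tsum_eq]
  refine add_le_add (le_of_eq ?_) (((summable_nat_add_iff 2).2 hsum).tsum_le_tsum hle hgeom.summable)
  simp

lemma integrable_exp_mul_abs_bernoulliGaussian (p t : ℝ) :
    Integrable (fun x : ℝ => Real.exp (t * |x|)) (bernoulliGaussian p) :=
  ((integrable_dirac (by simp)).smul_measure_nnreal).add_measure
    (integrable_exp_mul_abs_gaussianReal t).smul_measure_nnreal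

lemma integral_exp_mul_abs_bernoulliGaussian {p : ℝ} (hp0 : 0 ≤ p) (hp1 : p ≤ 1) (t : ℝ) :
    ∫ x, Real.exp (t * |x|) ∂(bernoulliGaussian p)
      = 1 - p + p * ∫ x, Real.exp (t * |x|) ∂(ProbabilityTheory.gaussianReal 0 1) := by
  rw [bernoulliGaussian, integral_add_measure (integrable_dirac (by simp)).smul_measure_nnreal
    (integrable_exp_mul_abs_gaussianReal t).smul_measure_nnreal,
    integral_smul_nnreal_measure, integral_smul_nnreal_measure, integral_dirac]
  simp [NNReal.smul_def, hp0, hp1]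

/-- **Theorem (concentration of the ℓ1 norm).** If `x ∈ ℝ^N` has i.i.d.
Bernoulli–Gaussian entries with parameter `p`, then for every `ε > 0`,
`ℙ(‖x‖₁ > Np(√(2/π)+ε)) ≤ 2·exp(−Npε²/(2+√2·ε))`. -/
theorem stmt13 (p : ℝ) (hp0 : 0 < p) (hp1 : p < 1) (N : ℕ) (hN : 0 < N)
    (ε : ℝ) (hε : 0 < ε) :
    Measure.pi (fun _ : Fin N => bernoulliGaussian p)
      {x | ∑ n, |x n| > N * p * (Real.sqrt (2 / Real.pi) + ε)}
      ≤ ENNReal.ofReal (2 * Real.exp (-(N * p * ε ^ 2) / (2 + Real.sqrt 2 * ε))) := by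
  set c := Real.sqrt 2 / 2 with hc
  set m := Real.sqrt (2 / Real.pi)
  set t := ε / (1 + c * ε) with ht
  have hd : 0 < 1 + c * ε := by positivity
  have ht0 : 0 ≤ t := by positivity
  have hct : 1 - c * t = (1 + c * ε)⁻¹ := by
    rw [ht]
    field_simp
    ring
  have ht1 : c * t < 1 := by
    have : 0 < (1 + c * ε)⁻¹ := by positivity
    linarith
  set A := ↑N * p * (m + ε)
  set P := Measure.pi (fun _ : Fin N => bernoulliGaussian p)
  have hexp (x : Fin N → ℝ) :
      Real.exp (t * ∑ n, |x n|) = ∏ n, Real.exp (t * |x n|) := by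
    rw [Finset.mul_sum, Real.exp_sum]
  have h_int : Integrable (fun x : Fin N → ℝ => Real.exp (t * ∑ n, |x n|)) P := by
    simp_rw [hexp]
    exact Integrable.fintype_prod (f := fun _ y => Real.exp (t * |y|))
      fun _ => integrable_exp_mul_abs_bernoulliGaussian p t
  have hmgf : ProbabilityTheory.mgf (fun x : Fin N → ℝ => ∑ n, |x n|) P t
      ≤ Real.exp (N * (p * (t * m + t ^ 2 / 2 * (1 + c * ε)))) := by
    rw [ProbabilityTheory.mgf]
    simp_rw [hexp]
    rw [integral_fintype_prod_eq_pow (fun y => Real.exp (t * |y|)), Fintype.card_fin,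
      Real.exp_nat_mul]
    refine pow_le_pow_left₀ (integral_nonneg fun x => ?_) ?_ N
    · positivity
    · rw [integral_exp_mul_abs_bernoulliGaussian hp0.le hp1.le]
      have h := integral_exp_mul_abs_gaussianReal_le ht0 ht1
      rw [← hc, hct, inv_inv] at h
      refine le_trans ?_ (Real.add_one_le_exp _)
      nlinarith [mul_le_mul_of_nonneg_left h hp0.le]
  have hexponent : -t * A + N * (p * (t * m + t ^ 2 / 2 * (1 + c * ε)))
      = -(N * p * ε ^ 2) / (2 + Real.sqrt 2 * ε) := by
    have h2 : 2 + Real.sqrt 2 * ε = 2 * (1 + c * ε) := by rw [hc]; ring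
    simp only [h2, ht, A]
    field_simp
    ring
  have hreal : P.real {x | A ≤ ∑ n, |x n|}
      ≤ Real.exp (-(N * p * ε ^ 2) / (2 + Real.sqrt 2 * ε)) := by
    refine (ProbabilityTheory.measure_ge_le_exp_mul_mgf A ht0 h_int).trans ?_
    rw [← hexponent, Real.exp_add]
    gcongr
  refine (measure_mono (t := {x : Fin N → ℝ | A ≤ ∑ n, |x n|})
    fun x (hx : A < ∑ n, |x n|) => hx.le).trans ?_
  rw [← ofReal_measureReal]
  refine ENNReal.ofReal_le_ofReal (hreal.trans ?_)
  linarith [Real.exp_pos (-(N * p * ε ^ 2) / (2 + Real.sqrt 2 * ε))]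
end
end
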